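/- Let m ∈ ℤ_{>0} and s, s₁ ∈ ℤ. For every τ with Im τ > 0 and all z₁, z₂ ∈ ℂ with z₁ ∉ ℤ + ℤτ, one has Φ̃^{[m;s]}(−1/τ, z₁/τ, z₂/τ) = τ · e^{2πi m z₁ z₂ / τ} · Φ̃^{[m;s₁]}(τ, z₁, z₂). -/

import Mathlib

noncomputable section

open Complex

/-- `mexp w = e^{2πi w}`. -/
def mexp (w : ℂ) : ℂ := Complex.exp (2 * (Real.pi : ℂ) * Complex.I * w)

/-- The signed mock theta function `Φ^{sgn[m;s]}(τ,z₁,z₂)`. -/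
def PhiS (sgn : ℂ) (m s : ℝ) (τ z₁ z₂ : ℂ) : ℂ :=
  ∑' n : ℤ, sgn ^ n *
    mexp ((m : ℂ) * n * (z₁ + z₂) + (s : ℂ) * z₁ + τ * ((m : ℂ) * n ^ 2 + (s : ℂ) * n)) /
    (1 - mexp (z₁ + n * τ))

/-- The signed theta function `Θ^{sgn}_{j,m}(τ,z)`. -/
def ThetaS (sgn : ℂ) (j m : ℝ) (τ z : ℂ) : ℂ :=
  ∑' n : ℤ, sgn ^ n *
    mexp ((m : ℂ) * z * ((n : ℂ) + ((j / (2 * m) : ℝ) : ℂ)) +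
      τ * (m : ℂ) * ((n : ℂ) + ((j / (2 * m) : ℝ) : ℂ)) ^ 2)

/-- `E(x) = 2∫₀ˣ e^{-πu²} du`. -/
def Efun (x : ℝ) : ℝ := 2 * ∫ u in (0:ℝ)..x, Real.exp (-Real.pi * u ^ 2)

/-- `ψ_{m,n}(τ,z) = (n - 2m Im z / Im τ) √(Im τ / m)`. -/
def psiMN (m n : ℝ) (τ z : ℂ) : ℝ := (n - 2 * m * z.im / τ.im) * Real.sqrt (τ.im / m)

/-- The real-analytic correction `R^{sgn}_{j,m}(τ,z)`; the summation variable `n ∈ j + 2mℤ`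
is written as `n = j + 2mk`, `k ∈ ℤ`, so that `(±1)^{(n-j)/(2m)} = sgn^k`. -/
def RS (sgn : ℂ) (j m : ℝ) (τ z : ℂ) : ℂ :=
  ∑' k : ℤ, sgn ^ k *
    (((Real.sign (j + 2 * m * k - 1 / 2 - j + 2 * m) -
        Efun (psiMN m (j + 2 * m * k) τ z) : ℝ)) : ℂ) *
    Complex.exp (-(Real.pi : ℂ) * Complex.I * (((j + 2 * m * k : ℝ)) : ℂ) ^ 2 * τ / (2 * (m : ℂ))
      + 2 * (Real.pi : ℂ) * Complex.I * (((j + 2 * m * k : ℝ)) : ℂ) * z)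

/-- The modifier `Φ^{sgn[m;s]}_add`; the summation variable `j ∈ s + ℤ`, `s ≤ j < s + 2m`
is written as `j = s + i`, `0 ≤ i < ⌈2m⌉`. -/
def PhiAddS (sgn : ℂ) (m s : ℝ) (τ z₁ z₂ : ℂ) : ℂ :=
  ∑ i ∈ Finset.range ⌈2 * m⌉₊,
    RS sgn (s + i) m τ ((z₁ - z₂) / 2) * ThetaS sgn (s + i) m τ (z₁ + z₂)

/-- The modified (signed) mock theta function `Φ̃^{sgn[m;s]}`. -/
def PhiTilde (sgn : ℂ) (m s : ℝ) (τ z₁ z₂ : ℂ) : ℂ :=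
  PhiS sgn m s τ z₁ z₂ - (1 / 2) * PhiAddS sgn m s τ z₁ z₂

end

section ModifiedMockTheta

open Complex

theorem Efun_neg (x : ℝ) : Efun (-x) = -Efun x := by
  unfold Efun
  have h := intervalIntegral.integral_comp_neg (a := 0) (b := x)
    (fun u : ℝ => Real.exp (-Real.pi * u ^ 2))
  simp only [neg_zero, even_two.neg_pow] at h
  rw [intervalIntegral.integral_symm, ← h]
  ring

theorem Efun_nonneg {x : ℝ} (hx : 0 ≤ x) : 0 ≤ Efun x :=
  mul_nonneg zero_le_two (intervalIntegral.integral_nonneg hx fun _ _ => (Real.exp_pos _).le)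

theorem one_sub_Efun (x : ℝ) :
    1 - Efun x = 2 * ∫ u in Set.Ioi x, Real.exp (-Real.pi * u ^ 2) := by
  have hint : MeasureTheory.Integrable (fun u : ℝ => Real.exp (-Real.pi * u ^ 2)) :=
    integrable_exp_neg_mul_sq Real.pi_pos
  have h := intervalIntegral.integral_interval_add_Ioi (a := 0) (b := x)
    hint.integrableOn hint.integrableOn
  rw [integral_gaussian_Ioi, div_self Real.pi_ne_zero, Real.sqrt_one] at h
  unfold Efun
  linarith

theorem abs_one_sub_Efun_le {x : ℝ} (hx : 0 ≤ x) :
    |1 - Efun x| ≤ Real.exp (-Real.pi * x ^ 2) := by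
  have hint : MeasureTheory.Integrable (fun u : ℝ => Real.exp (-Real.pi * u ^ 2)) :=
    integrable_exp_neg_mul_sq Real.pi_pos
  have hshift : ∫ u in Set.Ioi x, Real.exp (-Real.pi * (u - x) ^ 2) = 1 / 2 := by
    have h := (MeasureTheory.measurePreserving_sub_right MeasureTheory.volume x).setIntegral_preimage_emb
      (measurableEmbedding_subRight x) (fun u : ℝ => Real.exp (-Real.pi * u ^ 2)) (Set.Ioi 0)
    rw [Set.preimage_sub_const_Ioi, zero_add] at h
    rw [h, integral_gaussian_Ioi, div_self Real.pi_ne_zero, Real.sqrt_one]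
  have hle : ∫ u in Set.Ioi x, Real.exp (-Real.pi * u ^ 2) ≤
      ∫ u in Set.Ioi x, Real.exp (-Real.pi * x ^ 2) * Real.exp (-Real.pi * (u - x) ^ 2) := by
    refine MeasureTheory.setIntegral_mono_on hint.integrableOn
      ((hint.comp_sub_right x).const_mul _).integrableOn measurableSet_Ioi fun u hu => ?_
    rw [← Real.exp_add, Real.exp_le_exp]
    have : 0 ≤ x * (u - x) := mul_nonneg hx (sub_nonneg.2 (Set.mem_Ioi.1 hu).le)
    nlinarith [Real.pi_pos]
  rw [MeasureTheory.integral_const_mul, hshift] at hle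
  have h0 : 0 ≤ ∫ u in Set.Ioi x, Real.exp (-Real.pi * u ^ 2) :=
    MeasureTheory.setIntegral_nonneg measurableSet_Ioi fun _ _ => (Real.exp_pos _).le
  rw [one_sub_Efun, abs_of_nonneg (by positivity)]
  linarith

theorem abs_neg_one_sub_Efun_le {x : ℝ} (hx : x ≤ 0) :
    |-1 - Efun x| ≤ Real.exp (-Real.pi * x ^ 2) := by
  have h := abs_one_sub_Efun_le (neg_nonneg.2 hx)
  rwa [Efun_neg, neg_sq, ← abs_neg, show -(1 - -Efun x) = -1 - Efun x by ring] at h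

theorem abs_Efun_le_one (x : ℝ) : |Efun x| ≤ 1 := by
  have key : ∀ y : ℝ, 0 ≤ y → |Efun y| ≤ 1 := fun y hy => by
    have h : 0 ≤ 1 - Efun y := by
      rw [one_sub_Efun]
      exact mul_nonneg zero_le_two
        (MeasureTheory.setIntegral_nonneg measurableSet_Ioi fun _ _ => (Real.exp_pos _).le)
    rw [abs_of_nonneg (Efun_nonneg hy)]
    linarith
  rcases le_total 0 x with hx | hx
  · exact key x hx
  · have h := key (-x) (neg_nonneg.2 hx)
    rwa [Efun_neg, abs_neg] at h

theorem Efun_sub_Efun (c k a b : ℝ) :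
    Efun ((k - a) * c) - Efun ((k - b) * c) =
      2 * ∫ t in a..b, c * Real.exp (-Real.pi * (c * (k - t)) ^ 2) := by
  have hcont : Continuous fun u : ℝ => Real.exp (-Real.pi * u ^ 2) := by fun_prop
  have hint := fun p q : ℝ => hcont.intervalIntegrable (μ := MeasureTheory.volume) p q
  rw [intervalIntegral.integral_const_mul]
  have h := intervalIntegral.mul_integral_comp_sub_mul (a := a) (b := b)
    (f := fun u : ℝ => Real.exp (-Real.pi * u ^ 2)) c (c * k)
  rw [show (fun t : ℝ => Real.exp (-Real.pi * (c * (k - t)) ^ 2)) =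
    fun t : ℝ => Real.exp (-Real.pi * (c * k - c * t) ^ 2) by ext t; ring_nf, h]
  unfold Efun
  rw [← mul_sub, intervalIntegral.integral_interval_sub_left (hint _ _) (hint _ _)]
  congr 2 <;> ring

/-- The sign of `k - s + 1/2`, for integers `k` and `s`. -/
noncomputable def stepSign (s k : ℤ) : ℝ := if s ≤ k then 1 else -1

theorem stepSign_add_one (s k : ℤ) :
    stepSign s (k + 1) = stepSign s k + if k = s - 1 then 2 else 0 := by
  unfold stepSign
  split_ifs <;> first | omega | norm_num

theorem abs_stepSign (s k : ℤ) : |stepSign s k| = 1 := by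
  unfold stepSign
  split_ifs <;> simp

theorem abs_stepSign_sub_Efun_le (s : ℤ) {c : ℝ} (hc : 0 < c) (β : ℝ) (k : ℤ) :
    |stepSign s k - Efun ((k - β) * c)| ≤
      2 * Real.exp (Real.pi * (c * (s - β)) ^ 2) * Real.exp (-Real.pi * ((k - β) * c) ^ 2) := by
  have hone : 1 ≤ Real.exp (Real.pi * (c * (s - β)) ^ 2) := Real.one_le_exp (by positivity)
  have hpos := Real.exp_pos (-Real.pi * ((k - β) * c) ^ 2)
  have hgood : |stepSign s k - Efun ((k - β) * c)| ≤ Real.exp (-Real.pi * ((k - β) * c) ^ 2) →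
      |stepSign s k - Efun ((k - β) * c)| ≤ 2 * Real.exp (Real.pi * (c * (s - β)) ^ 2) *
        Real.exp (-Real.pi * ((k - β) * c) ^ 2) := fun h => h.trans (by nlinarith)
  have hbad : (k - β) ^ 2 ≤ (s - β) ^ 2 →
      |stepSign s k - Efun ((k - β) * c)| ≤ 2 * Real.exp (Real.pi * (c * (s - β)) ^ 2) *
        Real.exp (-Real.pi * ((k - β) * c) ^ 2) := fun h => by
    have h1 : |stepSign s k - Efun ((k - β) * c)| ≤ 2 :=
      (abs_sub _ _).trans (by rw [abs_stepSign]; linarith [abs_Efun_le_one ((k - β) * c)])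
    have h2 : 1 ≤ Real.exp (Real.pi * (c * (s - β)) ^ 2) *
        Real.exp (-Real.pi * ((k - β) * c) ^ 2) := by
      rw [← Real.exp_add]
      refine Real.one_le_exp ?_
      have : 0 ≤ Real.pi * c ^ 2 * ((s - β) ^ 2 - (k - β) ^ 2) :=
        mul_nonneg (by positivity) (sub_nonneg.2 h)
      linarith
    linarith
  rcases le_or_gt s k with hs | hs <;> rcases le_or_gt β k with hβ | hβ
  · apply hgood
    rw [stepSign, if_pos hs]
    exact abs_one_sub_Efun_le (mul_nonneg (by linarith) hc.le)
  · have : (s : ℝ) ≤ k := by exact_mod_cast hs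
    exact hbad (by nlinarith)
  · have : (k : ℝ) < s := by exact_mod_cast hs
    exact hbad (by nlinarith)
  · apply hgood
    rw [stepSign, if_neg hs.not_ge]
    exact abs_neg_one_sub_Efun_le (mul_nonpos_of_nonpos_of_nonneg (by linarith) hc.le)

theorem summable_exp_quadratic {a : ℝ} (ha : 0 < a) (b d : ℝ) :
    Summable fun n : ℤ => Real.exp (-a * n ^ 2 + b * n + d) := by
  have h := (((summable_jacobiTheta₂_term_iff (-I * b / (2 * Real.pi)) (I * a / Real.pi)).2
    (by simp [Complex.div_im]; positivity)).norm).mul_left (Real.exp d)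
  refine h.congr fun n => ?_
  rw [jacobiTheta₂_term, Complex.norm_exp, ← Real.exp_add]
  congr 1
  have hpi : (Real.pi : ℂ) ≠ 0 := by exact_mod_cast Real.pi_ne_zero
  have : 2 * (Real.pi : ℂ) * I * n * (-I * b / (2 * Real.pi)) +
      Real.pi * I * n ^ 2 * (I * a / Real.pi) = ((-a * n ^ 2 + b * n : ℝ) : ℂ) := by
    push_cast
    field_simp
    linear_combination (-(n : ℂ) * b + n ^ 2 * a) * Complex.I_sq
  rw [this, Complex.ofReal_re]
  ring

theorem summable_exp_quadratic_prod {a : ℝ} (ha : 0 < a) (b b' d : ℝ) (Q : ℤ × ℤ → ℝ)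
    (hQ : ∀ p : ℤ × ℤ, Q p ≤ -a * ((p.1 : ℝ) ^ 2 + p.2 ^ 2) + b * p.1 + b' * p.2 + d) :
    Summable fun p : ℤ × ℤ => Real.exp (Q p) := by
  have h := (summable_exp_quadratic ha b d).mul_of_nonneg (summable_exp_quadratic ha b' 0)
    (fun _ => (Real.exp_pos _).le) (fun _ => (Real.exp_pos _).le)
  refine Summable.of_nonneg_of_le (fun _ => (Real.exp_pos _).le) (fun p => ?_) h
  rw [← Real.exp_add, Real.exp_le_exp]
  linarith [hQ p]

theorem norm_mexp (w : ℂ) : ‖mexp w‖ = Real.exp (-2 * Real.pi * w.im) := by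
  rw [mexp, Complex.norm_exp]
  simp

theorem mexp_add (v w : ℂ) : mexp (v + w) = mexp v * mexp w := by
  rw [mexp, mexp, mexp, ← Complex.exp_add]
  ring_nf

theorem mexp_int (n : ℤ) : mexp n = 1 :=
  Complex.exp_eq_one_iff.2 ⟨n, by ring⟩

theorem mexp_eq_one_iff (w : ℂ) : mexp w = 1 ↔ ∃ n : ℤ, w = n := by
  rw [mexp, Complex.exp_eq_one_iff]
  refine exists_congr fun n => ?_
  rw [mul_comm (n : ℂ), mul_right_inj' Complex.two_pi_I_ne_zero]

theorem summable_stepSign_sub_Efun_mul (s : ℤ) {c : ℝ} (hc : 0 < c) (β : ℝ) (Z : ℂ) :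
    Summable fun k : ℤ => ((stepSign s k - Efun ((k - β) * c) : ℝ) : ℂ) * mexp (k * Z) := by
  have h := (summable_exp_quadratic (a := Real.pi * c ^ 2) (by positivity)
    (2 * Real.pi * c ^ 2 * β - 2 * Real.pi * Z.im) (-Real.pi * c ^ 2 * β ^ 2)).mul_left
    (2 * Real.exp (Real.pi * (c * (s - β)) ^ 2))
  refine h.of_norm_bounded fun k => ?_
  rw [norm_mul, norm_mexp, Complex.norm_real, Real.norm_eq_abs]
  refine (mul_le_mul_of_nonneg_right (abs_stepSign_sub_Efun_le s hc β k)
    (Real.exp_pos _).le).trans_eq ?_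
  rw [mul_assoc, ← Real.exp_add]
  congr 2
  simp
  ring

theorem summable_cexp_gaussian {c : ℝ} (hc : 0 < c) (Z : ℂ) :
    Summable fun l : ℤ => cexp (-Real.pi * (Z - l) ^ 2 / c ^ 2) := by
  refine Summable.of_norm ((summable_exp_quadratic (a := Real.pi / c ^ 2) (by positivity)
    (2 * Real.pi / c ^ 2 * Z.re) (-Real.pi / c ^ 2 * (Z.re ^ 2 - Z.im ^ 2))).congr fun l => ?_)
  rw [Complex.norm_exp]
  congr 1
  rw [← Complex.ofReal_pow, Complex.div_ofReal_re]
  simp [sq]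
  field_simp
  ring

theorem summable_gaussian_mul_mexp {c : ℝ} (hc : 0 < c) (t : ℝ) (Z : ℂ) :
    Summable fun k : ℤ => ((c * Real.exp (-Real.pi * (c * (k - t)) ^ 2) : ℝ) : ℂ) *
      mexp (k * Z) := by
  refine ((summable_exp_quadratic (a := Real.pi * c ^ 2) (by positivity)
    (2 * Real.pi * c ^ 2 * t - 2 * Real.pi * Z.im) (-Real.pi * c ^ 2 * t ^ 2)).mul_left
    c).of_norm_bounded fun k => ?_
  rw [norm_mul, norm_mexp, Complex.norm_real, Real.norm_of_nonneg (by positivity), mul_assoc,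
    ← Real.exp_add]
  refine le_of_eq ?_
  congr 2
  simp
  ring

theorem tsum_gaussian_mul_mexp {c : ℝ} (hc : 0 < c) (t : ℝ) (Z : ℂ) :
    ∑' k : ℤ, ((c * Real.exp (-Real.pi * (c * (k - t)) ^ 2) : ℝ) : ℂ) * mexp (k * Z) =
      ∑' l : ℤ, cexp (2 * Real.pi * I * (Z - l) * t) * cexp (-Real.pi * (Z - l) ^ 2 / c ^ 2) := by
  have hc' : (c : ℂ) ≠ 0 := by exact_mod_cast hc.ne'
  have h := Complex.tsum_exp_neg_quadratic (a := (c : ℂ) ^ 2)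
    (by rw [← Complex.ofReal_pow, Complex.ofReal_re]; positivity) (c ^ 2 * t + I * Z)
  have hsqrt : ((c : ℂ) ^ 2) ^ (1 / 2 : ℂ) = c := by
    rw [show ((c : ℂ) ^ 2) = ((c ^ 2 : ℝ) : ℂ) by push_cast; rfl,
      show (1 / 2 : ℂ) = ((1 / 2 : ℝ) : ℂ) by push_cast; rfl,
      ← Complex.ofReal_cpow (by positivity), ← Real.sqrt_eq_rpow, Real.sqrt_sq hc.le]
  rw [hsqrt] at h
  have hl : ∀ k : ℤ, ((c * Real.exp (-Real.pi * (c * (k - t)) ^ 2) : ℝ) : ℂ) * mexp (k * Z) =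
      c * cexp (-Real.pi * c ^ 2 * t ^ 2) *
        cexp (-Real.pi * c ^ 2 * k ^ 2 + 2 * Real.pi * (c ^ 2 * t + I * Z) * k) := fun k => by
    rw [mexp]
    push_cast
    rw [mul_assoc (c : ℂ), mul_assoc (c : ℂ), ← Complex.exp_add, ← Complex.exp_add]
    ring_nf
  have hr : ∀ l : ℤ, cexp (2 * Real.pi * I * (Z - l) * t) *
      cexp (-Real.pi * (Z - l) ^ 2 / c ^ 2) = cexp (-Real.pi * c ^ 2 * t ^ 2) *
        cexp (-Real.pi / c ^ 2 * (l + I * (c ^ 2 * t + I * Z)) ^ 2) := fun l => by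
    rw [← Complex.exp_add, ← Complex.exp_add]
    congr 1
    field_simp
    linear_combination (t ^ 2 * c ^ 4 + 2 * I * Z * c ^ 2 * t + 2 * l * Z
      + (I ^ 2 - 1) * Z ^ 2) * Complex.I_sq
  simp_rw [hl, hr, tsum_mul_left, h]
  field_simp

theorem integral_cexp_linear {a : ℂ} (ha : a ≠ 0) (β : ℝ) :
    ∫ t : ℝ in β..β + 1, cexp (2 * Real.pi * I * a * t) =
      cexp (2 * Real.pi * I * β * a) * (mexp a - 1) / (2 * Real.pi * I * a) := by
  rw [integral_exp_mul_complex (mul_ne_zero Complex.two_pi_I_ne_zero ha), mexp, mul_sub,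
    ← Complex.exp_add]
  push_cast
  ring_nf

theorem hasSum_intervalIntegral_of_const_bound {F : ℤ → ℝ → ℂ} {f : ℝ → ℂ} {bound : ℤ → ℝ}
    {β : ℝ} (hcont : ∀ k, Continuous (F k)) (hb : ∀ k, ∀ t ∈ Set.Icc β (β + 1), ‖F k t‖ ≤ bound k)
    (hs : Summable bound) (hf : ∀ t, HasSum (fun k => F k t) (f t)) :
    HasSum (fun k => ∫ t in β..β + 1, F k t) (∫ t in β..β + 1, f t) := by
  refine intervalIntegral.hasSum_integral_of_dominated_convergence (fun k _ => bound k)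
    (fun k => (hcont k).aestronglyMeasurable) (fun k => .of_forall fun t ht => hb k t ?_)
    (.of_forall fun _ _ => hs) intervalIntegrable_const (.of_forall fun t _ => hf t)
  rw [Set.uIoc_of_le (by linarith)] at ht
  exact Set.Ioc_subset_Icc_self ht

/-- Poisson summation for the geometric series regularised by the error function: the partial
fraction expansion of `1 / (1 - e^{2πiZ})` with Gaussian convergence factors. -/
theorem hasSum_gaussian_div_sub_int (s : ℤ) {c : ℝ} (hc : 0 < c) (β : ℝ) {Z : ℂ}
    (hZ : ∀ n : ℤ, Z ≠ n) :
    HasSum (fun l : ℤ => cexp (2 * Real.pi * I * β * (Z - l)) *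
        cexp (-Real.pi * (Z - l) ^ 2 / c ^ 2) / (Z - l))
      (-(2 * Real.pi * I) * (mexp (s * Z) / (1 - mexp Z) -
        1 / 2 * ∑' k : ℤ, ((stepSign s k - Efun ((k - β) * c) : ℝ) : ℂ) * mexp (k * Z))) := by
  have hw : mexp Z - 1 ≠ 0 := by
    rw [sub_ne_zero, Ne, mexp_eq_one_iff]
    exact fun ⟨n, hn⟩ => hZ n hn
  set S : ℝ → ℂ := fun β =>
    ∑' k : ℤ, ((stepSign s k - Efun ((k - β) * c) : ℝ) : ℂ) * mexp (k * Z) with hS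
  have hsum := fun b : ℝ => summable_stepSign_sub_Efun_mul s hc b Z
  have hshift : S (β + 1) = mexp Z * S β + 2 * mexp (s * Z) := by
    have h1 := (hsum β).hasSum.mul_left (mexp Z)
    have h2 := hasSum_ite_eq (s - 1) (2 * mexp (s * Z))
    have h3 := (h1.add h2).tsum_eq
    rw [hS]
    simp only
    rw [← h3, ← (Equiv.addRight (1 : ℤ)).tsum_eq]
    refine tsum_congr fun k => ?_
    rw [Equiv.coe_addRight, stepSign_add_one]
    have he : mexp (((k + 1 : ℤ) : ℂ) * Z) = mexp Z * mexp (k * Z) := by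
      rw [← mexp_add]; push_cast; ring_nf
    rw [he]
    have hr : ((k + 1 : ℤ) : ℝ) - (β + 1) = k - β := by push_cast; ring
    rw [hr]
    split_ifs with hk
    · have hs : mexp (s * Z) = mexp Z * mexp (k * Z) := by rw [← he, hk]; ring_nf
      rw [hs]
      push_cast
      ring
    · push_cast
      ring
  set P : ℝ → ℂ := fun t =>
    ∑' k : ℤ, ((c * Real.exp (-Real.pi * (c * (k - t)) ^ 2) : ℝ) : ℂ) * mexp (k * Z) with hP
  have hleft : HasSum (fun k : ℤ => ∫ t in β..β + 1,
      ((c * Real.exp (-Real.pi * (c * (k - t)) ^ 2) : ℝ) : ℂ) * mexp (k * Z))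
      (∫ t in β..β + 1, P t) := by
    refine hasSum_intervalIntegral_of_const_bound (bound := fun k : ℤ => c *
      Real.exp (-(Real.pi * c ^ 2 / 2) * k ^ 2 + (Real.pi * c ^ 2 * β - 2 * Real.pi * Z.im) * k +
        (-Real.pi * c ^ 2 * β ^ 2 / 2 + Real.pi * c ^ 2))) (fun k => by fun_prop)
      (fun k t ht => ?_)
      ((summable_exp_quadratic (by positivity) _ _).mul_left c)
      (fun t => (summable_gaussian_mul_mexp hc t Z).hasSum)
    rw [norm_mul, norm_mexp, Complex.norm_real, Real.norm_of_nonneg (by positivity), mul_assoc,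
      ← Real.exp_add]
    refine mul_le_mul_of_nonneg_left (Real.exp_le_exp.2 ?_) hc.le
    have h1 : (k - β) ^ 2 / 2 - 1 ≤ ((k : ℝ) - t) ^ 2 := by
      nlinarith [ht.1, ht.2, sq_nonneg ((k - t) - (t - β))]
    have h2 := mul_le_mul_of_nonneg_left h1 (by positivity : 0 ≤ Real.pi * c ^ 2)
    simp
    linarith
  have hright : HasSum (fun l : ℤ => ∫ t : ℝ in β..β + 1,
      cexp (2 * Real.pi * I * (Z - l) * t) * cexp (-Real.pi * (Z - l) ^ 2 / c ^ 2))
      (∫ t in β..β + 1, P t) := by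
    have hbound : ∀ (l : ℤ) (t : ℝ), t ∈ Set.Icc β (β + 1) →
        ‖cexp (2 * Real.pi * I * (Z - l) * t) * cexp (-Real.pi * (Z - l) ^ 2 / c ^ 2)‖ ≤
          Real.exp (2 * Real.pi * ((|β| + 1) * |Z.im|)) *
            ‖cexp (-Real.pi * (Z - l) ^ 2 / c ^ 2)‖ := fun l t ht => by
      rw [norm_mul]
      refine mul_le_mul_of_nonneg_right ?_ (norm_nonneg _)
      rw [Complex.norm_exp, Real.exp_le_exp]
      have h1 : |t| ≤ |β| + 1 :=
        abs_le.2 ⟨by linarith [ht.1, neg_abs_le β], by linarith [ht.2, le_abs_self β]⟩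
      have h2 : -(t * Z.im) ≤ (|β| + 1) * |Z.im| := by
        refine (neg_le_abs _).trans ?_
        rw [abs_mul]
        exact mul_le_mul_of_nonneg_right h1 (abs_nonneg _)
      have h3 := mul_le_mul_of_nonneg_left h2 Real.two_pi_pos.le
      simp
      linarith
    refine hasSum_intervalIntegral_of_const_bound (fun l => by fun_prop) hbound
      ((summable_cexp_gaussian hc Z).norm.mul_left _) (fun t => ?_)
    rw [hP]
    simp only
    rw [tsum_gaussian_mul_mexp hc]
    refine Summable.hasSum (Summable.of_norm_bounded
      ((summable_cexp_gaussian hc Z).norm.mul_left (Real.exp (2 * Real.pi * -(Z.im * t))))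
      fun l => ?_)
    rw [norm_mul, Complex.norm_exp (2 * Real.pi * I * (Z - l) * t)]
    refine le_of_eq ?_
    congr 2
    simp
    ring
  have hdiff : S (β + 1) - S β = 2 * ∫ t in β..β + 1, P t := by
    rw [hS]
    simp only
    rw [← (hsum (β + 1)).tsum_sub (hsum β), ← hleft.tsum_eq, ← tsum_mul_left]
    refine tsum_congr fun k => ?_
    rw [← sub_mul, intervalIntegral.integral_mul_const, ← mul_assoc, intervalIntegral.integral_ofReal]
    congr 1
    have h := Efun_sub_Efun c k β (β + 1)
    rw [← Complex.ofReal_sub, sub_sub_sub_cancel_left, h]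
    push_cast
    rfl
  have hfin := hright.mul_left (2 * Real.pi * I / (mexp Z - 1))
  have hval : 2 * Real.pi * I / (mexp Z - 1) * ∫ t in β..β + 1, P t =
      -(2 * Real.pi * I) * (mexp (s * Z) / (1 - mexp Z) - 1 / 2 * S β) := by
    have h : ∫ t in β..β + 1, P t = (mexp Z - 1) * S β / 2 + mexp (s * Z) := by
      linear_combination (hshift - hdiff) / 2
    have hw' : 1 - mexp Z ≠ 0 := by rwa [← neg_sub, neg_ne_zero]
    rw [h]
    field_simp
    ring
  rw [hval] at hfin
  refine hfin.congr_fun fun l => ?_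
  have hl : Z - l ≠ 0 := sub_ne_zero.2 (hZ l)
  have hper : mexp (Z - l) = mexp Z := by
    rw [← mul_one (mexp (Z - l)), ← mexp_int l, ← mexp_add, sub_add_cancel]
  rw [intervalIntegral.integral_mul_const, integral_cexp_linear hl, hper]
  have hpi : (Real.pi : ℂ) ≠ 0 := by exact_mod_cast Real.pi_ne_zero
  field_simp

open ComplexConjugate in
/-- The Gaussian factor of the term of index `(n, l)` in the lattice sum that represents the
modified mock theta function. -/
noncomputable def latticeGauss (m : ℕ) (τ z₁ z₂ : ℂ) (p : ℤ × ℤ) : ℂ :=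
  cexp (2 * Real.pi * I * m / (τ - conj τ) *
    ((p.1 * τ - p.2) * (conj z₂ - conj z₁) - (p.1 * conj τ - p.2) * (z₁ + z₂) -
      (p.1 * τ - p.2) * (p.1 * conj τ - p.2) + z₁ * (conj z₂ - z₂ - conj z₁)))

theorem norm_latticeGauss (m : ℕ) {τ : ℂ} (hτ : 0 < τ.im) (z₁ z₂ : ℂ) (p : ℤ × ℤ) :
    ‖latticeGauss m τ z₁ z₂ p‖ = Real.exp (-(Real.pi * m / τ.im) *
      normSq (z₁ + (p.1 * τ - p.2)) + Real.pi * m / τ.im * (2 * z₁.im * z₂.im)) := by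
  have hy : (τ.im : ℂ) ≠ 0 := by exact_mod_cast hτ.ne'
  have h : 2 * (Real.pi : ℂ) * I * m / (τ - starRingEnd ℂ τ) = ((Real.pi * m / τ.im : ℝ) : ℂ) := by
    rw [Complex.sub_conj]
    push_cast
    field_simp
  rw [latticeGauss, Complex.norm_exp, h, Complex.re_ofReal_mul]
  congr 1
  rw [neg_mul, neg_add_eq_sub, ← mul_sub]
  congr 1
  simp [Complex.normSq_apply]
  ring

theorem summable_norm_latticeGauss {m : ℕ} (hm : 0 < m) {τ : ℂ} (hτ : 0 < τ.im) (z₁ z₂ : ℂ) :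
    Summable fun p : ℤ × ℤ => ‖latticeGauss m τ z₁ z₂ p‖ := by
  simp_rw [norm_latticeGauss m hτ]
  have hm' : (0 : ℝ) < m := by exact_mod_cast hm
  set x := τ.re
  set y := τ.im
  refine summable_exp_quadratic_prod
    (a := Real.pi * m / y * (y ^ 2 / (1 + x ^ 2 + y ^ 2)) / 2) (by positivity) 0 0
    (Real.pi * m / y * (normSq z₁ + 2 * z₁.im * z₂.im)) _ fun p => ?_
  have h1 : y ^ 2 / (1 + x ^ 2 + y ^ 2) * ((p.1 : ℝ) ^ 2 + p.2 ^ 2) ≤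
      (p.1 * x - p.2) ^ 2 + (p.1 * y) ^ 2 := by
    rw [div_mul_eq_mul_div, div_le_iff₀ (by positivity)]
    nlinarith [sq_nonneg (((x ^ 2 + y ^ 2) * p.1 - x * p.2 : ℝ)), sq_nonneg (p.2 - x * p.1 : ℝ)]
  have h2 : ((p.1 * x - p.2) ^ 2 + (p.1 * y) ^ 2) / 2 - normSq z₁ ≤
      normSq (z₁ + (p.1 * τ - p.2)) := by
    simp only [Complex.normSq_apply, Complex.add_re, Complex.sub_re, Complex.mul_re,
      Complex.intCast_re, Complex.intCast_im, Complex.add_im, Complex.sub_im, Complex.mul_im]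
    nlinarith [sq_nonneg (p.1 * x - p.2 + 2 * z₁.re), sq_nonneg (p.1 * y + 2 * z₁.im)]
  have h3 := mul_le_mul_of_nonneg_left ((sub_le_sub_right
    (div_le_div_of_nonneg_right h1 zero_le_two) _).trans h2)
    (by positivity : 0 ≤ Real.pi * m / y)
  linarith

theorem summable_latticeGauss_div {m : ℕ} (hm : 0 < m) {τ : ℂ} (hτ : 0 < τ.im) (z₁ z₂ : ℂ) :
    Summable fun p : ℤ × ℤ => latticeGauss m τ z₁ z₂ p / (z₁ + (p.1 * τ - p.2)) := by
  have hs := summable_norm_latticeGauss hm hτ z₁ z₂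
  refine Summable.of_norm_bounded_eventually hs ?_
  have ha : 0 < Real.pi * m / τ.im := by
    have : (0 : ℝ) < m := by exact_mod_cast hm
    positivity
  filter_upwards [hs.tendsto_cofinite_zero.eventually_lt_const (Real.exp_pos
    (-(Real.pi * m / τ.im) * 1 + Real.pi * m / τ.im * (2 * z₁.im * z₂.im)))] with p hp
  rw [norm_latticeGauss m hτ, Real.exp_lt_exp, add_lt_add_iff_right, neg_mul, neg_mul,
    neg_lt_neg_iff, mul_lt_mul_iff_right₀ ha, Complex.normSq_eq_norm_sq] at hp
  rw [norm_div]
  refine div_le_self (norm_nonneg _) ?_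
  nlinarith [norm_nonneg (z₁ + (p.1 * τ - p.2))]

open ComplexConjugate in
theorem latticeGauss_S (m : ℕ) {τ : ℂ} (hτ : 0 < τ.im) (z₁ z₂ : ℂ) (n l : ℤ) :
    latticeGauss m (-1 / τ) (z₁ / τ) (z₂ / τ) (n, l) =
      cexp (2 * Real.pi * I * m * z₁ * z₂ / τ) * latticeGauss m τ z₁ z₂ (-l, n) := by
  have hτ0 : τ ≠ 0 := fun h => by simp [h] at hτ
  have hc0 : conj τ ≠ 0 := by simpa using hτ0
  have hd : τ - conj τ ≠ 0 := by
    rw [Complex.sub_conj]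
    simp [hτ.ne']
  rw [latticeGauss, latticeGauss, ← Complex.exp_add]
  congr 1
  simp only [map_div₀, map_neg, map_one]
  have hsub : -1 / τ - -1 / conj τ = (τ - conj τ) / (τ * conj τ) := by
    field_simp
    ring
  rw [hsub]
  push_cast
  field_simp
  ring

theorem latticeGauss_eq {m : ℕ} (hm : 0 < m) {τ : ℂ} (hτ : 0 < τ.im) (z₁ z₂ : ℂ) (n l : ℤ) :
    mexp (m * n * (z₁ + z₂) + τ * (m * n ^ 2)) *
      (cexp (2 * Real.pi * I * ((2 * m * ((z₁ - z₂) / 2).im / τ.im : ℝ) : ℂ) *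
        (z₁ + n * τ - l)) *
      cexp (-Real.pi * (z₁ + n * τ - l) ^ 2 / (Real.sqrt (τ.im / m) : ℂ) ^ 2)) =
    latticeGauss m τ z₁ z₂ (n, l) := by
  have hm' : (m : ℂ) ≠ 0 := by exact_mod_cast hm.ne'
  have hy : (τ.im : ℂ) ≠ 0 := by exact_mod_cast hτ.ne'
  have hsq : (Real.sqrt (τ.im / m) : ℂ) ^ 2 = τ.im / m := by
    rw [← Complex.ofReal_pow, Real.sq_sqrt (by positivity)]
    push_cast
    rfl
  have hone : cexp (2 * Real.pi * I * ((-(m * n * l) : ℤ) : ℂ)) = 1 := mexp_int _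
  rw [hsq, mexp, latticeGauss, ← Complex.exp_add, ← Complex.exp_add, ← mul_one (cexp _), ← hone,
    ← Complex.exp_add]
  congr 1
  have hconj : ∀ w : ℂ, starRingEnd ℂ w = w - 2 * w.im * I := fun w => by
    have := Complex.sub_conj w
    push_cast at this
    linear_combination -this
  have him : (((z₁ - z₂) / 2).im : ℝ) = (z₁.im - z₂.im) / 2 := by simp
  rw [him]
  simp only [hconj]
  rw [sub_sub_cancel]
  push_cast
  field_simp
  ring_nf

theorem sum_range_tsum_residue {N : ℕ} (hN : 0 < N) (s : ℤ) {g : ℤ → ℂ} (hg : Summable g) :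
    ∑ i ∈ Finset.range N, ∑' k : ℤ, g (s + i + N * k) = ∑' k : ℤ, g k := by
  have : NeZero N := ⟨hN.ne'⟩
  let e : ℤ × Fin N ≃ ℤ := (Int.divModEquiv N).symm.trans (Equiv.addLeft s)
  have he : ∀ p : ℤ × Fin N, e p = s + (p.2 : ℕ) + N * p.1 := fun p => by
    change s + ((Int.divModEquiv N).symm p) = _
    rw [Int.divModEquiv_symm_apply]
    ring
  have hs : Summable fun p : Fin N × ℤ => g (e p.swap) :=
    hg.comp_injective (e.injective.comp Prod.swap_injective)
  rw [← e.tsum_eq, ← (Equiv.prodComm (Fin N) ℤ).tsum_eq]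
  simp only [Equiv.prodComm_apply]
  rw [hs.tsum_prod, tsum_fintype, Finset.sum_range]
  simp only [Prod.swap_prod_mk, he]

theorem summable_stepSign_sub_Efun_mul_prod {m : ℕ} (hm : 0 < m) (s : ℤ) {τ : ℂ} (hτ : 0 < τ.im)
    (β : ℝ) (z₁ w : ℂ) :
    Summable fun p : ℤ × ℤ => mexp (m * p.1 * w + τ * (m * p.1 ^ 2)) *
      (((stepSign s p.2 - Efun ((p.2 - β) * Real.sqrt (τ.im / m)) : ℝ) : ℂ) *
        mexp (p.2 * (z₁ + p.1 * τ))) := by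
  have hm' : (0 : ℝ) < m := by exact_mod_cast hm
  set y := τ.im with hy
  set c := Real.sqrt (y / m) with hc
  have hcpos : 0 < c := Real.sqrt_pos.2 (by positivity)
  have hc2 : c ^ 2 = y / m := Real.sq_sqrt (by positivity)
  have h := (summable_exp_quadratic_prod (a := 2 * Real.pi * y * min ((m : ℝ) / 4) (1 / (6 * m)))
    (by positivity) (-2 * Real.pi * m * w.im) (2 * Real.pi * (y / m) * β - 2 * Real.pi * z₁.im)
    (-Real.pi * (y / m) * β ^ 2)
    (fun p : ℤ × ℤ => -Real.pi * ((p.2 - β) * c) ^ 2 + -2 * Real.pi *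
      (m * p.1 * w.im + y * (m * p.1 ^ 2) + p.2 * (z₁.im + p.1 * y))) fun p => ?_).mul_left
    (2 * Real.exp (Real.pi * (c * (s - β)) ^ 2))
  · refine h.of_norm_bounded fun p => ?_
    rw [norm_mul, norm_mul, norm_mexp, norm_mexp, Complex.norm_real, Real.norm_eq_abs,
      mul_left_comm, ← Real.exp_add]
    refine (mul_le_mul_of_nonneg_right (abs_stepSign_sub_Efun_le s hcpos β p.2)
      (Real.exp_pos _).le).trans_eq ?_
    rw [mul_assoc, ← Real.exp_add]
    congr 2
    simp [← hy, sq]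
    ring
  · have h1 : min ((m : ℝ) / 4) (1 / (6 * m)) * ((p.1 : ℝ) ^ 2 + p.2 ^ 2) ≤
        m * p.1 ^ 2 + p.1 * p.2 + p.2 ^ 2 / (2 * m) := by
      have e : (m : ℝ) * p.1 ^ 2 + p.1 * p.2 + p.2 ^ 2 / (2 * m) = m / 4 * p.1 ^ 2 +
          1 / (6 * m) * p.2 ^ 2 + 3 / 4 * m * (p.1 + 2 / (3 * m) * p.2) ^ 2 := by
        field_simp
        ring
      rw [e, mul_add]
      have := mul_le_mul_of_nonneg_right (min_le_left ((m : ℝ) / 4) (1 / (6 * m)))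
        (sq_nonneg (p.1 : ℝ))
      have := mul_le_mul_of_nonneg_right (min_le_right ((m : ℝ) / 4) (1 / (6 * m)))
        (sq_nonneg (p.2 : ℝ))
      have : 0 ≤ 3 / 4 * (m : ℝ) * (p.1 + 2 / (3 * m) * p.2) ^ 2 := by positivity
      linarith
    have h2 := mul_le_mul_of_nonneg_left h1 (by positivity : 0 ≤ 2 * Real.pi * y)
    have h3 : 2 * Real.pi * y * ((p.2 : ℝ) ^ 2 / (2 * m)) = Real.pi * (y / m) * p.2 ^ 2 := by
      field_simp
    rw [mul_pow, hc2]
    linarith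

theorem ThetaS_mul_cexp {m : ℕ} (hm : 0 < m) (j k : ℤ) (τ z₁ z₂ : ℂ) :
    cexp (-(Real.pi : ℂ) * I * ((j + 2 * m * k : ℝ) : ℂ) ^ 2 * τ / (2 * ((m : ℝ) : ℂ)) +
        2 * (Real.pi : ℂ) * I * ((j + 2 * m * k : ℝ) : ℂ) * ((z₁ - z₂) / 2)) *
      ThetaS 1 j m τ (z₁ + z₂) =
    ∑' n : ℤ, mexp (m * n * (z₁ + z₂) + τ * (m * n ^ 2)) *
      mexp (((j + 2 * m * k : ℤ) : ℂ) * (z₁ + n * τ)) := by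
  have hm' : (m : ℂ) ≠ 0 := by exact_mod_cast hm.ne'
  rw [ThetaS, ← tsum_mul_left, ← (Equiv.addRight k).tsum_eq]
  refine tsum_congr fun n => ?_
  rw [one_zpow, one_mul, mexp, ← mexp_add, mexp, ← Complex.exp_add]
  congr 1
  rw [Equiv.coe_addRight]
  push_cast
  field_simp
  ring

theorem hasSum_PhiAddS {m : ℕ} (hm : 0 < m) (s : ℤ) {τ : ℂ} (hτ : 0 < τ.im) (z₁ z₂ : ℂ) :
    HasSum (fun n : ℤ => mexp (m * n * (z₁ + z₂) + τ * (m * n ^ 2)) *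
      ∑' k : ℤ, ((stepSign s k - Efun ((k - 2 * m * ((z₁ - z₂) / 2).im / τ.im) *
        Real.sqrt (τ.im / m)) : ℝ) : ℂ) * mexp (k * (z₁ + n * τ)))
      (PhiAddS 1 m s τ z₁ z₂) := by
  have hm' : (0 : ℝ) < m := by exact_mod_cast hm
  set β := 2 * m * ((z₁ - z₂) / 2).im / τ.im with hβ
  set F : ℤ × ℤ → ℂ := fun p => mexp (m * p.1 * (z₁ + z₂) + τ * (m * p.1 ^ 2)) *
    (((stepSign s p.2 - Efun ((p.2 - β) * Real.sqrt (τ.im / m)) : ℝ) : ℂ) *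
      mexp (p.2 * (z₁ + p.1 * τ))) with hFdef
  have hF : Summable F := summable_stepSign_sub_Efun_mul_prod hm s hτ β z₁ (z₁ + z₂)
  have hval : PhiAddS 1 m s τ z₁ z₂ = ∑' p, F p := by
    have hceil : ⌈2 * (m : ℝ)⌉₊ = 2 * m := by
      rw [← Nat.cast_ofNat, ← Nat.cast_mul, Nat.ceil_natCast]
    have hswap : ∑' p, F p = ∑' k, ∑' n, F (n, k) :=
      ((Equiv.prodComm ℤ ℤ).tsum_eq F).symm.trans hF.prod_symm.tsum_prod
    have hrow : Summable fun k => ∑' n, F (n, k) := hF.prod_symm.prod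
    rw [hswap, ← sum_range_tsum_residue (Nat.mul_pos two_pos hm) s hrow, PhiAddS, hceil]
    refine Finset.sum_congr rfl fun i hi => ?_
    rw [RS, ← tsum_mul_right]
    refine tsum_congr fun k => ?_
    have hsign : Real.sign ((s + i : ℝ) + 2 * m * k - 1 / 2 - (s + i) + 2 * m) =
        stepSign s (s + i + (2 * m : ℕ) * k) := by
      rw [show (s + i : ℝ) + 2 * m * k - 1 / 2 - (s + i) + 2 * m = 2 * m * (k + 1) - 1 / 2 by ring]
      have hi' : (i : ℤ) < (2 * m : ℕ) := by exact_mod_cast Finset.mem_range.1 hi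
      have hm1 : (1 : ℝ) ≤ m := by exact_mod_cast hm
      unfold stepSign
      rcases le_or_gt 0 k with hk | hk
      · have hk' : (0 : ℝ) ≤ k := by exact_mod_cast hk
        rw [if_pos (by nlinarith [mul_nonneg (Int.natCast_nonneg (2 * m)) hk]),
          Real.sign_of_pos (by nlinarith)]
      · have hk' : (k : ℝ) + 1 ≤ 0 := by exact_mod_cast hk
        rw [if_neg (by nlinarith), Real.sign_of_neg (by nlinarith)]
    have hθ := ThetaS_mul_cexp hm (s + i) k τ z₁ z₂
    push_cast at hθ
    rw [one_zpow, one_mul, hsign, mul_assoc]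
    push_cast
    rw [hθ, ← tsum_mul_left]
    refine tsum_congr fun n => ?_
    simp only [hFdef]
    rw [psiMN, ← hβ]
    push_cast
    ring
  rw [hval]
  have h := hF.hasSum.prod_fiberwise fun n =>
    (hF.prod_factor n).hasSum
  simpa only [hFdef, tsum_mul_left] using h

/-- The modified mock theta function as a lattice sum, manifestly independent of `s`. -/
theorem PhiTilde_eq_tsum {m : ℕ} (hm : 0 < m) (s : ℤ) {τ : ℂ} (hτ : 0 < τ.im) {z₁ : ℂ} (z₂ : ℂ)
    (hz : ∀ a b : ℤ, z₁ ≠ a + b * τ) :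
    PhiTilde 1 m s τ z₁ z₂ = -(2 * Real.pi * I)⁻¹ *
      ∑' p : ℤ × ℤ, latticeGauss m τ z₁ z₂ p / (z₁ + (p.1 * τ - p.2)) := by
  have hm' : (0 : ℝ) < m := by exact_mod_cast hm
  have hL := summable_latticeGauss_div hm hτ z₁ z₂
  have hrow := hL.hasSum.prod_fiberwise (g := fun n : ℤ =>
    -(2 * Real.pi * I) * (mexp (m * n * (z₁ + z₂) + τ * (m * n ^ 2)) *
      (mexp (s * (z₁ + n * τ)) / (1 - mexp (z₁ + n * τ)) - 1 / 2 *
        ∑' k : ℤ, ((stepSign s k - Efun ((k - 2 * m * ((z₁ - z₂) / 2).im / τ.im) *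
          Real.sqrt (τ.im / m)) : ℝ) : ℂ) * mexp (k * (z₁ + n * τ))))) fun n => by
    have hZ : ∀ a : ℤ, z₁ + n * τ ≠ a := fun a h => hz a (-n) (by
      push_cast
      linear_combination h)
    have h := (hasSum_gaussian_div_sub_int s
      (Real.sqrt_pos.2 (by positivity : 0 < τ.im / m))
      (2 * m * ((z₁ - z₂) / 2).im / τ.im) hZ).mul_left
      (mexp (m * n * (z₁ + z₂) + τ * (m * n ^ 2)))
    rw [mul_left_comm (mexp _) (-(2 * Real.pi * I))] at h
    refine h.congr_fun fun l => ?_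
    rw [← latticeGauss_eq hm hτ, mul_div_assoc, add_sub_assoc]
  have hφ := (hrow.mul_left (-(2 * Real.pi * I)⁻¹)).add
    ((hasSum_PhiAddS hm s hτ z₁ z₂).mul_left (1 / 2))
  have hterm : PhiS 1 m s τ z₁ z₂ = -(2 * Real.pi * I)⁻¹ *
      ∑' p : ℤ × ℤ, latticeGauss m τ z₁ z₂ p / (z₁ + (p.1 * τ - p.2)) +
      1 / 2 * PhiAddS 1 m s τ z₁ z₂ := by
    rw [← hφ.tsum_eq, PhiS]
    refine tsum_congr fun n => ?_
    have he : mexp ((((m : ℝ) : ℂ)) * n * (z₁ + z₂) + ((s : ℝ) : ℂ) * z₁ +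
        τ * (((m : ℝ) : ℂ) * n ^ 2 + ((s : ℝ) : ℂ) * n)) =
        mexp (m * n * (z₁ + z₂) + τ * (m * n ^ 2)) * mexp (s * (z₁ + n * τ)) := by
      rw [← mexp_add]
      congr 1
      push_cast
      ring
    rw [he, one_zpow, one_mul, neg_mul, neg_mul, mul_neg, neg_neg,
      inv_mul_cancel_left₀ Complex.two_pi_I_ne_zero]
    ring
  rw [PhiTilde, hterm]
  ring

theorem tsum_latticeGauss_S (m : ℕ) {τ : ℂ} (hτ : 0 < τ.im) (z₁ z₂ : ℂ) :
    ∑' p : ℤ × ℤ, latticeGauss m (-1 / τ) (z₁ / τ) (z₂ / τ) p /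
        (z₁ / τ + (p.1 * (-1 / τ) - p.2)) =
      τ * cexp (2 * Real.pi * I * m * z₁ * z₂ / τ) *
        ∑' p : ℤ × ℤ, latticeGauss m τ z₁ z₂ p / (z₁ + (p.1 * τ - p.2)) := by
  have hτ0 : τ ≠ 0 := fun h => by simp [h] at hτ
  rw [← ((Equiv.prodComm ℤ ℤ).trans ((Equiv.neg ℤ).prodCongr (Equiv.refl ℤ))).tsum_eq
    fun p : ℤ × ℤ => latticeGauss m τ z₁ z₂ p / (z₁ + (p.1 * τ - p.2)), ← tsum_mul_left]
  refine tsum_congr fun ⟨n, l⟩ => ?_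
  have hd : z₁ / τ + (n * (-1 / τ) - l) = (z₁ + (((-l : ℤ) : ℂ) * τ - n)) / τ := by
    field_simp
    push_cast
    ring
  simp only [Equiv.trans_apply, Equiv.prodComm_apply, Prod.swap_prod_mk, Equiv.prodCongr_apply,
    Prod.map_apply, Equiv.neg_apply, Equiv.refl_apply]
  rw [hd, latticeGauss_S m hτ, div_div_eq_mul_div]
  ring

end ModifiedMockTheta

/-- S-transformation of the modified mock theta function `Φ̃^{[m;s]}`,
`m ∈ ℤ_{>0}`, `s, s₁ ∈ ℤ`. -/
theorem stmt0 (m s s₁ : ℤ) (hm : 0 < m) (τ z₁ z₂ : ℂ) (hτ : 0 < τ.im)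
    (hz : ∀ a b : ℤ, z₁ ≠ (a : ℂ) + (b : ℂ) * τ) :
    PhiTilde 1 (m : ℝ) (s : ℝ) (-1 / τ) (z₁ / τ) (z₂ / τ) =
      τ * Complex.exp (2 * (Real.pi : ℂ) * Complex.I * (m : ℂ) * z₁ * z₂ / τ) *
        PhiTilde 1 (m : ℝ) (s₁ : ℝ) τ z₁ z₂ := by
  lift m to ℕ using hm.le
  have hm' : 0 < m := by exact_mod_cast hm
  have hτ0 : τ ≠ 0 := fun h => by simp [h] at hτ
  have hτ' : 0 < (-1 / τ).im := by
    have h : (-1 / τ).im = τ.im / Complex.normSq τ := by simp [neg_div]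
    rw [h]
    exact div_pos hτ (Complex.normSq_pos.2 hτ0)
  have hz' : ∀ a b : ℤ, z₁ / τ ≠ a + b * (-1 / τ) := fun a b h => hz (-b) a (by
    field_simp at h
    push_cast
    linear_combination h)
  simp only [Int.cast_natCast]
  rw [PhiTilde_eq_tsum hm' s hτ' _ hz', PhiTilde_eq_tsum hm' s₁ hτ _ hz, tsum_latticeGauss_S m hτ]
  ring
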